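/- Let I, J be admissible ideals on ℕ and A = (a_{n,k}) an infinite real matrix. If A satisfies (T1) sup_n ∑_k |a_{n,k}| < ∞ and (T3) J-lim_n ∑_{k∈E} |a_{n,k}| = 0 for every E ∈ I, then A ∈ (c₀(I) ∩ ℓ∞, c₀(J) ∩ ℓ∞). Moreover, every matrix A ∈ (c₀(I) ∩ ℓ∞, c₀(J) ∩ ℓ∞) satisfies (T1). -/

import Mathlib

open Filter Topology

/-- `x ∈ ℓ∞`: `x` is a bounded real sequence. -/
def Bdd (x : ℕ → ℝ) : Prop := ∃ C : ℝ, ∀ n, |x n| ≤ C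

/-- An admissible ideal on `ℕ`: a family of subsets of `ℕ` closed under taking
subsets and finite unions, containing every finite set, and not containing `ℕ`. -/
def IsAdmissibleIdeal (I : Set (Set ℕ)) : Prop :=
  (∀ A ∈ I, ∀ B ⊆ A, B ∈ I) ∧
  (∀ A ∈ I, ∀ B ∈ I, A ∪ B ∈ I) ∧
  (∀ A : Set ℕ, A.Finite → A ∈ I) ∧
  (Set.univ : Set ℕ) ∉ I

/-- `I`-convergence of the sequence `x` to `η`. -/
def IdealLim (I : Set (Set ℕ)) (x : ℕ → ℝ) (η : ℝ) : Prop :=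
  ∀ ε : ℝ, 0 < ε → {n : ℕ | ε < |x n - η|} ∈ I

/-- `(Ax)ₙ = ∑ₖ a n k * x k`. -/
noncomputable def matMul (a : ℕ → ℕ → ℝ) (x : ℕ → ℝ) : ℕ → ℝ :=
  fun n => ∑' k, a n k * x k

/-- Condition (T1): `sup_n ∑ₖ |a n k| < ∞`. -/
def CondT1 (a : ℕ → ℕ → ℝ) : Prop :=
  ∃ C : ℝ, ∀ n : ℕ, ∀ F : Finset ℕ, ∑ k ∈ F, |a n k| ≤ C

/-- Condition (T2): the rows of `a` are summable and `J-lim_n ∑ₖ a n k = 1`. -/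
def CondT2 (J : Set (Set ℕ)) (a : ℕ → ℕ → ℝ) : Prop :=
  (∀ n, Summable (a n)) ∧ IdealLim J (fun n => ∑' k, a n k) 1

/-- Condition (T3): `J-lim_n ∑_{k ∈ E} |a n k| = 0` for every `E ∈ I`. -/
def CondT3 (I J : Set (Set ℕ)) (a : ℕ → ℕ → ℝ) : Prop :=
  ∀ E ∈ I, IdealLim J (fun n => ∑' k, E.indicator (fun j => |a n j|) k) 0

/-- `A` is `(I, J)`-regular: `A` maps every bounded `I`-convergent sequence to a
(well-defined) bounded `J`-convergent sequence and preserves the ideal limits. -/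
def IJRegular (I J : Set (Set ℕ)) (a : ℕ → ℕ → ℝ) : Prop :=
  ∀ x : ℕ → ℝ, Bdd x → ∀ η : ℝ, IdealLim I x η →
    (∀ n, Summable fun k => a n k * x k) ∧ Bdd (matMul a x) ∧
      IdealLim J (matMul a x) η

/-- The ideal `Z` of sets of asymptotic density zero. -/
def densityZeroIdeal : Set (Set ℕ) :=
  {S : Set ℕ | Tendsto
    (fun n : ℕ => (∑ k ∈ Finset.Icc 1 n, S.indicator (fun _ => (1 : ℝ)) k) / n)
    atTop (𝓝 0)}

open scoped ZeroAtInfty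

/-- Every null sequence of reals, bundled as an element of the Banach space `c₀`. -/
noncomputable def nullSeq (x : ℕ → ℝ) (hx : Tendsto x atTop (𝓝 0)) : C₀(ℕ, ℝ) where
  toFun := x
  continuous_toFun := continuous_of_discreteTopology
  zero_at_infty' := by
    rwa [cocompact_eq_cofinite, Nat.cofinite_eq_atTop]

theorem tendsto_coe_zeroAtInfty (x : C₀(ℕ, ℝ)) : Tendsto x atTop (𝓝 0) := by
  have h := x.zero_at_infty'
  rwa [cocompact_eq_cofinite, Nat.cofinite_eq_atTop] at h

theorem abs_coe_le_norm_zeroAtInfty (x : C₀(ℕ, ℝ)) (k : ℕ) : |x k| ≤ ‖x‖ :=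
  x.toBCF.norm_coe_le_norm k

theorem norm_nullSeq_le {x : ℕ → ℝ} {hx : Tendsto x atTop (𝓝 0)} {C : ℝ} (hC : 0 ≤ C)
    (h : ∀ k, |x k| ≤ C) : ‖nullSeq x hx‖ ≤ C :=
  ((nullSeq x hx).toBCF.norm_le hC).2 h

theorem summable_abs_mul {b x : ℕ → ℝ} {C : ℝ} (hb : Summable fun k => |b k|)
    (hx : ∀ k, |x k| ≤ C) : Summable fun k => |b k * x k| :=
  (hb.mul_right C).of_nonneg_of_le (fun _ => abs_nonneg _) fun k => by
    rw [abs_mul]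
    exact mul_le_mul_of_nonneg_left (hx k) (abs_nonneg _)

theorem abs_tsum_le_tsum_abs {f : ℕ → ℝ} (hf : Summable fun k => |f k|) :
    |∑' k, f k| ≤ ∑' k, |f k| := by
  simpa only [Real.norm_eq_abs] using norm_tsum_le_tsum_norm (f := f) hf

theorem abs_tsum_mul_le {b x : ℕ → ℝ} {C : ℝ} (hb : Summable fun k => |b k|)
    (hx : ∀ k, |x k| ≤ C) : |∑' k, b k * x k| ≤ (∑' k, |b k|) * C := by
  have h := summable_abs_mul hb hx
  calc |∑' k, b k * x k| ≤ ∑' k, |b k * x k| := abs_tsum_le_tsum_abs h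
    _ ≤ ∑' k, |b k| * C := h.tsum_le_tsum (fun k => by
        rw [abs_mul]
        exact mul_le_mul_of_nonneg_left (hx k) (abs_nonneg _)) (hb.mul_right C)
    _ = (∑' k, |b k|) * C := tsum_mul_right

/-- The continuous functional on `c₀` given by an absolutely summable sequence. -/
noncomputable def rowFunctional (b : ℕ → ℝ) (hb : Summable fun k => |b k|) : C₀(ℕ, ℝ) →L[ℝ] ℝ :=
  LinearMap.mkContinuous
    { toFun := fun x => ∑' k, b k * x k
      map_add' := fun x y => by
        have hx := (summable_abs_mul hb (abs_coe_le_norm_zeroAtInfty x)).of_abs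
        have hy := (summable_abs_mul hb (abs_coe_le_norm_zeroAtInfty y)).of_abs
        rw [← hx.tsum_add hy]
        exact tsum_congr fun k => mul_add _ _ _
      map_smul' := fun c x => by
        rw [RingHom.id_apply, smul_eq_mul, ← tsum_mul_left]
        exact tsum_congr fun k => mul_left_comm _ _ _ }
    (∑' k, |b k|) fun x => abs_tsum_mul_le hb (abs_coe_le_norm_zeroAtInfty x)

theorem rowFunctional_apply (b : ℕ → ℝ) (hb : Summable fun k => |b k|) (x : C₀(ℕ, ℝ)) :
    rowFunctional b hb x = ∑' k, b k * x k := rfl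

theorem sum_abs_le_norm_rowFunctional (b : ℕ → ℝ) (hb : Summable fun k => |b k|) (F : Finset ℕ) :
    ∑ k ∈ F, |b k| ≤ ‖rowFunctional b hb‖ := by
  classical
  let g : ℕ → ℝ := fun k => if k ∈ F then (SignType.sign (b k) : ℝ) else 0
  have hg : Tendsto g atTop (𝓝 0) := by
    refine tendsto_const_nhds.congr' ?_
    filter_upwards [Nat.cofinite_eq_atTop ▸ F.finite_toSet.compl_mem_cofinite] with k hk
    exact (if_neg hk).symm
  have hg1 : ∀ k, |g k| ≤ 1 := fun k => by
    by_cases hk : k ∈ F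
    · rcases lt_trichotomy (b k) 0 with h | h | h <;> simp [g, hk, h]
    · simp [g, hk]
  have hsum : rowFunctional b hb (nullSeq g hg) = ∑ k ∈ F, |b k| := by
    rw [rowFunctional_apply]
    change ∑' k, b k * g k = _
    rw [tsum_eq_sum (s := F) fun k hk => by simp [g, hk]]
    exact Finset.sum_congr rfl fun k hk => by simp [g, hk, self_mul_sign]
  calc ∑ k ∈ F, |b k| ≤ ‖rowFunctional b hb (nullSeq g hg)‖ := by
        rw [hsum]; exact le_abs_self _
    _ ≤ ‖rowFunctional b hb‖ * 1 :=
        (rowFunctional b hb).le_opNorm_of_le (norm_nullSeq_le zero_le_one hg1)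
    _ = _ := mul_one _

/-- Uniform boundedness for absolutely summable sequences acting on null sequences. -/
theorem exists_sum_abs_le_of_pointwise_bounded {ι : Type*} (b : ι → ℕ → ℝ)
    (hb : ∀ i, Summable fun k => |b i k|)
    (h : ∀ x : ℕ → ℝ, Tendsto x atTop (𝓝 0) → ∃ C, ∀ i, |∑' k, b i k * x k| ≤ C) :
    ∃ C, ∀ i, ∀ F : Finset ℕ, ∑ k ∈ F, |b i k| ≤ C := by
  obtain ⟨C, hC⟩ := banach_steinhaus (g := fun i => rowFunctional (b i) (hb i))
    fun x => h x (tendsto_coe_zeroAtInfty x)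
  exact ⟨C, fun i F => (sum_abs_le_norm_rowFunctional _ (hb i) F).trans (hC i)⟩

/-- A sequence whose products with all null sequences are summable is absolutely summable. -/
theorem summable_abs_of_forall_summable_mul (b : ℕ → ℝ)
    (h : ∀ x : ℕ → ℝ, Tendsto x atTop (𝓝 0) → Summable fun k => b k * x k) :
    Summable fun k => |b k| := by
  classical
  let t : Finset ℕ → ℕ → ℝ := fun F k => if k ∈ F then b k else 0
  obtain ⟨C, hC⟩ := exists_sum_abs_le_of_pointwise_bounded t
    (fun F => summable_of_ne_finset_zero (s := F) fun k hk => by simp [t, hk])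
    (fun x hx => ⟨∑' k, |b k * x k|, fun F => by
      rw [tsum_eq_sum (s := F) fun k hk => by simp [t, hk],
        Finset.sum_congr rfl fun k hk => show t F k * x k = b k * x k by simp [t, hk]]
      exact (Finset.abs_sum_le_sum_abs _ _).trans
        ((h x hx).abs.sum_le_tsum F fun _ _ => abs_nonneg _)⟩)
  refine summable_of_sum_le (c := C) (fun _ => abs_nonneg _) fun F => ?_
  rw [Finset.sum_congr rfl fun k hk => show |b k| = |t F k| by simp [t, hk]]
  exact hC F F

theorem bdd_of_tendsto {x : ℕ → ℝ} (hx : Tendsto x atTop (𝓝 0)) : Bdd x :=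
  ⟨‖nullSeq x hx‖, abs_coe_le_norm_zeroAtInfty (nullSeq x hx)⟩

/-- Ordinary convergence implies convergence with respect to an admissible ideal. -/
theorem IsAdmissibleIdeal.idealLim_of_tendsto {I : Set (Set ℕ)} (hI : IsAdmissibleIdeal I)
    {x : ℕ → ℝ} {η : ℝ} (hx : Tendsto x atTop (𝓝 η)) : IdealLim I x η := by
  intro ε hε
  refine hI.2.2.1 _ ?_
  have h := (Metric.tendsto_nhds.1 hx) ε hε
  rw [← Nat.cofinite_eq_atTop] at h
  refine (eventually_cofinite.1 h).subset fun n hn => ?_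
  exact fun hlt => lt_asymm hn hlt

theorem abs_tsum_mul_le_indicator {b x : ℕ → ℝ} {B δ : ℝ} (hb : Summable fun k => |b k|)
    (hδ : 0 ≤ δ) (hx : ∀ k, |x k| ≤ B) :
    |∑' k, b k * x k| ≤
      B * (∑' k, {k | δ < |x k|}.indicator (fun j => |b j|) k) + δ * ∑' k, |b k| := by
  have h := summable_abs_mul hb hx
  have hE := (hb.indicator {k | δ < |x k|}).mul_left B
  have hd := hb.mul_left δ
  rw [← tsum_mul_left, ← tsum_mul_left, ← hE.tsum_add hd]
  refine (abs_tsum_le_tsum_abs h).trans (h.tsum_le_tsum (fun k => ?_) (hE.add hd))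
  rw [abs_mul]
  by_cases hk : δ < |x k|
  · rw [Set.indicator_of_mem (show k ∈ {k | δ < |x k|} from hk)]
    nlinarith [mul_le_mul_of_nonneg_left (hx k) (abs_nonneg (b k)),
      mul_nonneg hδ (abs_nonneg (b k))]
  · rw [Set.indicator_of_notMem (show k ∉ {k | δ < |x k|} from hk)]
    nlinarith [mul_le_mul_of_nonneg_left (not_lt.1 hk) (abs_nonneg (b k))]

/-- If `A` satisfies (T1) and (T3), then `A ∈ (c₀(I) ∩ ℓ∞, c₀(J) ∩ ℓ∞)`;
moreover every matrix in `(c₀(I) ∩ ℓ∞, c₀(J) ∩ ℓ∞)` satisfies (T1). -/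
theorem c0I_c0J_of_T1_T3 (I J : Set (Set ℕ))
    (hI : IsAdmissibleIdeal I) (hJ : IsAdmissibleIdeal J) (a : ℕ → ℕ → ℝ) :
    ((CondT1 a ∧ CondT3 I J a) →
      ∀ x : ℕ → ℝ, Bdd x → IdealLim I x 0 →
        (∀ n, Summable fun k => a n k * x k) ∧ Bdd (matMul a x) ∧
          IdealLim J (matMul a x) 0) ∧
    ((∀ x : ℕ → ℝ, Bdd x → IdealLim I x 0 →
        (∀ n, Summable fun k => a n k * x k) ∧ Bdd (matMul a x) ∧
          IdealLim J (matMul a x) 0) → CondT1 a) := by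
  constructor
  · rintro ⟨⟨C, hC⟩, h3⟩ x ⟨B, hB⟩ hx
    have hs : ∀ n, Summable fun k => |a n k| := fun n =>
      summable_of_sum_le (fun _ => abs_nonneg _) (hC n)
    have ht : ∀ n, ∑' k, |a n k| ≤ C := fun n =>
      (hs n).tsum_le_of_sum_le (hC n)
    have hB0 : 0 ≤ B := (abs_nonneg _).trans (hB 0)
    have hC0 : 0 ≤ C := (tsum_nonneg fun _ => abs_nonneg _).trans (ht 0)
    refine ⟨fun n => (summable_abs_mul (hs n) hB).of_abs, ⟨C * B, fun n =>
      (abs_tsum_mul_le (hs n) hB).trans (mul_le_mul_of_nonneg_right (ht n) hB0)⟩, ?_⟩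
    intro ε hε
    have hδ : 0 < ε / (2 * (C + 1)) := by positivity
    have hη : 0 < ε / (2 * (B + 1)) := by positivity
    have hE := hx _ hδ
    simp only [sub_zero] at hE
    refine hJ.1 _ (h3 _ hE _ hη) _ fun n hn => ?_
    simp only [Set.mem_ofPred_eq, sub_zero] at hn ⊢
    by_contra! hle
    have hS := (le_abs_self _).trans hle
    have key := abs_tsum_mul_le_indicator (hs n) hδ.le hB
    have h1 := mul_le_mul_of_nonneg_left hS hB0
    have h2 := mul_le_mul_of_nonneg_left (ht n) hδ.le
    have e1 : B * (ε / (2 * (B + 1))) ≤ ε / 2 := by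
      rw [← mul_div_assoc, div_le_div_iff₀ (by positivity) two_pos]
      nlinarith
    have e2 : ε / (2 * (C + 1)) * C ≤ ε / 2 := by
      rw [div_mul_eq_mul_div, div_le_div_iff₀ (by positivity) two_pos]
      nlinarith
    change ε < |∑' k, a n k * x k| at hn
    linarith
  · intro h
    have h0 := fun (x : ℕ → ℝ) (hx : Tendsto x atTop (𝓝 0)) =>
      h x (bdd_of_tendsto hx) (hI.idealLim_of_tendsto hx)
    exact exists_sum_abs_le_of_pointwise_bounded a
      (fun n => summable_abs_of_forall_summable_mul (a n) fun x hx => (h0 x hx).1 n)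
      fun x hx => (h0 x hx).2.1
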